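/- arXiv:1206.4961 — 12 statements merged into one kernel-verified Lean document; each statement's English description precedes it below -/
import Mathlib

section
/- Let ω ∈ ℂ with ω²+ω+1 = 0, let ψ ∈ ℂ with ψ ≠ 0, and let γ ∈ ℂ satisfy γ¹⁰ − (1/9)γ⁵ + (2/(3ψ))⁵ = 0. Set b = (3/2)ψγ² and c = (1/2)(1−ω)ψγ. Then for all u, v ∈ ℂ: u⁵ + v⁵ + (bu)⁵ + (cu+ωv)⁵ + (−ω²(cu−v))⁵ = 5ψ·u·v·(bu)·(cu+ωv)·(−ω²(cu−v)); that is, the van Geemen line (u, v, bu, cu+ωv, −ω²(cu−v)) lies in the Dwork quintic M_ψ. -/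
/-- The van Geemen line `(u, v, bu, cu+ωv, −ω²(cu−v))` lies in the Dwork quintic `M_ψ`
when `b = (3/2)ψγ²`, `c = (1/2)(1−ω)ψγ` and `γ` satisfies
`γ¹⁰ − (1/9)γ⁵ + (2/(3ψ))⁵ = 0`. -/
theorem van_geemen_line_in_dwork_quintic (ω ψ γ b c : ℂ)
    (hω : ω ^ 2 + ω + 1 = 0) (hψ : ψ ≠ 0)
    (hγ : γ ^ 10 - (1 / 9) * γ ^ 5 + (2 / (3 * ψ)) ^ 5 = 0)
    (hb : b = (3 / 2) * ψ * γ ^ 2)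
    (hc : c = (1 / 2) * (1 - ω) * ψ * γ) :
    ∀ u v : ℂ,
      u ^ 5 + v ^ 5 + (b * u) ^ 5 + (c * u + ω * v) ^ 5 + (-ω ^ 2 * (c * u - v)) ^ 5
        = 5 * ψ * u * v * (b * u) * (c * u + ω * v) * (-ω ^ 2 * (c * u - v)) := by
  have cube : ω ^ 3 = 1 := by linear_combination (ω - 1) * hω
  have quintic : 243 * ψ ^ 5 * γ ^ 10 - 27 * ψ ^ 5 * γ ^ 5 + 32 = 0 := by
    field_simp at hγ
    linear_combination hγ / 9
  have c_sq : c ^ 2 * ω ^ 2 = -(ψ * b) / 2 := by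
    subst hb hc
    linear_combination ψ ^ 2 * γ ^ 2 / 4 * (ω ^ 2 * hω - 3 * cube)
  have u_coeff : 1 + b ^ 5 + c ^ 5 * (1 - ω) = 0 := by
    have sixth : (1 - ω) ^ 6 = -27 := by
      have sq : (1 - ω) ^ 2 = -3 * ω := by linear_combination hω
      calc (1 - ω) ^ 6 = ((1 - ω) ^ 2) ^ 3 := by ring
        _ = -27 := by rw [sq]; linear_combination -27 * cube
    subst hb hc
    linear_combination quintic / 32 + ψ ^ 5 * γ ^ 5 / 32 * sixth
  intro u v
  clear hb hc hγ quintic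
  grind
end

section
/- Let σ, τ, δ, κ, p ∈ ℂ with κ ≠ 0, σ ≠ 0, τ ≠ 0, (1−σ)(1−σ+σ²) ≠ 0, (1−στ)(1−στ+σ²τ²) ≠ 0, and 1−στ+σ²τ² ≠ 0. Consider the four equations: (i) 1 + κ⁵τ⁴(1+δ⁵στ) = pτ; (ii) 1 + κ⁵τ³(1+δ⁵σ²τ²) = (1/2)p(1+τ+στ); (iii) 1 + κ⁵τ²(1+δ⁵σ³τ³) = (1/2)p(1+σ+στ); (iv) 1 + κ⁵τ(1+δ⁵σ⁴τ⁴) = pσ. If (i)–(iv) hold, then combining them with multiples (1,−2,2,−1) yields δ⁵ = (1−τ)(1−τ+τ²)/(στ⁴(1−σ)(1−σ+σ²)). Conversely, if δ⁵ = (1−τ)(1−τ+τ²)/(στ⁴(1−σ)(1−σ+σ²)), κ⁵ = −(1−σ)(1−σ+σ²)/(τ(1−στ)(1−στ+σ²τ²)), and p = 2(1−σ)(1−τ)/(1−στ+σ²τ²), then all four equations (i)–(iv) hold. -/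
/-- The four central equations obtained from the condition that a general line lies in
the Dwork quintic (after scalings).  Combining them with multiples `(1,−2,2,−1)` forces
the stated value of `δ⁵`; conversely, the stated values of `δ⁵`, `κ⁵` and `p` imply all
four equations. -/
theorem four_central_equations (σ τ δ κ p : ℂ)
    (hκ : κ ≠ 0) (hσ : σ ≠ 0) (hτ : τ ≠ 0)
    (hA : (1 - σ) * (1 - σ + σ ^ 2) ≠ 0)
    (hB : (1 - σ * τ) * (1 - σ * τ + σ ^ 2 * τ ^ 2) ≠ 0)
    (hC : 1 - σ * τ + σ ^ 2 * τ ^ 2 ≠ 0) :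
    ((1 + κ ^ 5 * τ ^ 4 * (1 + δ ^ 5 * σ * τ) = p * τ ∧
      1 + κ ^ 5 * τ ^ 3 * (1 + δ ^ 5 * σ ^ 2 * τ ^ 2) = (1 / 2) * p * (1 + τ + σ * τ) ∧
      1 + κ ^ 5 * τ ^ 2 * (1 + δ ^ 5 * σ ^ 3 * τ ^ 3) = (1 / 2) * p * (1 + σ + σ * τ) ∧
      1 + κ ^ 5 * τ * (1 + δ ^ 5 * σ ^ 4 * τ ^ 4) = p * σ) →
      δ ^ 5 = (1 - τ) * (1 - τ + τ ^ 2) / (σ * τ ^ 4 * (1 - σ) * (1 - σ + σ ^ 2))) ∧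
    ((δ ^ 5 = (1 - τ) * (1 - τ + τ ^ 2) / (σ * τ ^ 4 * (1 - σ) * (1 - σ + σ ^ 2)) ∧
      κ ^ 5 = -((1 - σ) * (1 - σ + σ ^ 2)) /
        (τ * (1 - σ * τ) * (1 - σ * τ + σ ^ 2 * τ ^ 2)) ∧
      p = 2 * ((1 - σ) * (1 - τ)) / (1 - σ * τ + σ ^ 2 * τ ^ 2)) →
      (1 + κ ^ 5 * τ ^ 4 * (1 + δ ^ 5 * σ * τ) = p * τ ∧
       1 + κ ^ 5 * τ ^ 3 * (1 + δ ^ 5 * σ ^ 2 * τ ^ 2) = (1 / 2) * p * (1 + τ + σ * τ) ∧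
       1 + κ ^ 5 * τ ^ 2 * (1 + δ ^ 5 * σ ^ 3 * τ ^ 3) = (1 / 2) * p * (1 + σ + σ * τ) ∧
       1 + κ ^ 5 * τ * (1 + δ ^ 5 * σ ^ 4 * τ ^ 4) = p * σ)) := by
  have hσ₁ : 1 - σ ≠ 0 := left_ne_zero_of_mul hA
  have hσ₂ : 1 - σ + σ ^ 2 ≠ 0 := right_ne_zero_of_mul hA
  have hστ : 1 - σ * τ ≠ 0 := left_ne_zero_of_mul hB
  constructor
  · rintro ⟨h₁, h₂, h₃, h₄⟩
    have hden : σ * τ ^ 4 * (1 - σ) * (1 - σ + σ ^ 2) ≠ 0 := by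
      simp [hσ, hτ, hσ₁, hσ₂]
    rw [eq_div_iff hden]
    have hκτ : κ ^ 5 * τ ≠ 0 := mul_ne_zero (pow_ne_zero 5 hκ) hτ
    apply mul_left_cancel₀ hκτ
    linear_combination h₁ - 2 * h₂ + 2 * h₃ - h₄
  · rintro ⟨hδ, hκ₅, hp⟩
    rw [hδ, hκ₅, hp]
    refine ⟨?_, ?_, ?_, ?_⟩ <;> field_simp <;> ring
end

section
/- Let σ, τ, δ, κ, p, c, s, ψ ∈ ℂ with δ ≠ 0, κ ≠ 0, τ ≠ 0, σ ≠ 0, (1−σ)(1−σ+σ²) ≠ 0, (1−στ)(1−στ+σ²τ²) ≠ 0, and 1−στ+σ²τ² ≠ 0. Suppose δ⁵ = (1−τ)(1−τ+τ²)/(στ⁴(1−σ)(1−σ+σ²)), κ⁵ = −(1−σ)(1−σ+σ²)/(τ(1−στ)(1−στ+σ²τ²)), p = 2(1−σ)(1−τ)/(1−στ+σ²τ²), and suppose furthermore 1 + c⁵(1 + κ⁵τ⁵(1+δ⁵)) = 0, 1 + s⁵(1 + κ⁵(1+δ⁵σ⁵τ⁵)) = 0, and ψ·δκ²τ = c·s·p.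 Then F(σ,τ;ψ) = 0. -/
/-- `F(σ,τ;ψ)`, whose vanishing is the constraint on `(σ,τ)` parametrizing lines on the
Dwork quintic `M_ψ`. -/
noncomputable def F (σ τ ψ : ℂ) : ℂ :=
  32 * σ ^ 2 * τ ^ 2 * (1 - σ) ^ 2 * (1 - τ) ^ 2 * (1 - σ * τ) ^ 2 -
    (1 - σ + σ ^ 2) * (1 - τ + τ ^ 2) * (1 - σ * τ + σ ^ 2 * τ ^ 2) *
      (1 - τ * (1 + σ) + τ ^ 2 * (1 - σ + σ ^ 2)) *
      (1 - σ * (1 + τ) + σ ^ 2 * (1 - τ + τ ^ 2)) * ψ ^ 5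

/-- The six conditions for a general line to lie in the Dwork quintic `M_ψ`, after the
scalings `r = sκ`, `b = cκτ`, `d = cκτδ`, `t = sκτδσ`, `ψ = (cs/(δκ²τ))p`, imply the
constraint `F(σ,τ;ψ) = 0`. -/
theorem constraint_F_vanishes (σ τ δ κ p c s ψ : ℂ)
    (hδ : δ ≠ 0) (hκ : κ ≠ 0) (hτ : τ ≠ 0) (hσ : σ ≠ 0)
    (hA : (1 - σ) * (1 - σ + σ ^ 2) ≠ 0)
    (hB : (1 - σ * τ) * (1 - σ * τ + σ ^ 2 * τ ^ 2) ≠ 0)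
    (hC : 1 - σ * τ + σ ^ 2 * τ ^ 2 ≠ 0)
    (hδ5 : δ ^ 5 = (1 - τ) * (1 - τ + τ ^ 2) / (σ * τ ^ 4 * (1 - σ) * (1 - σ + σ ^ 2)))
    (hκ5 : κ ^ 5 = -((1 - σ) * (1 - σ + σ ^ 2)) /
      (τ * (1 - σ * τ) * (1 - σ * τ + σ ^ 2 * τ ^ 2)))
    (hp : p = 2 * ((1 - σ) * (1 - τ)) / (1 - σ * τ + σ ^ 2 * τ ^ 2))
    (hc : 1 + c ^ 5 * (1 + κ ^ 5 * τ ^ 5 * (1 + δ ^ 5)) = 0)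
    (hs : 1 + s ^ 5 * (1 + κ ^ 5 * (1 + δ ^ 5 * σ ^ 5 * τ ^ 5)) = 0)
    (hψ : ψ * (δ * κ ^ 2 * τ) = c * s * p) :
    F σ τ ψ = 0 := by
  have h1 : 1 - σ ≠ 0 := left_ne_zero_of_mul hA
  have h2 : 1 - σ + σ ^ 2 ≠ 0 := right_ne_zero_of_mul hA
  have h3 : 1 - σ * τ ≠ 0 := left_ne_zero_of_mul hB
  have h4 : 1 - τ ≠ 0 := by
    intro h
    apply pow_ne_zero 5 hδ
    rw [hδ5, h]
    simp
  have hX : 1 + κ ^ 5 * τ ^ 5 * (1 + δ ^ 5) =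
      -((1 - σ) * (1 - τ) * (1 - τ * (1 + σ) + τ ^ 2 * (1 - σ + σ ^ 2))) /
        (σ * (1 - σ * τ + σ ^ 2 * τ ^ 2)) := by
    rw [hδ5, hκ5]
    field_simp
    ring
  have hY : 1 + κ ^ 5 * (1 + δ ^ 5 * σ ^ 5 * τ ^ 5) =
      -((1 - σ) * (1 - τ) * (1 - σ * (1 + τ) + σ ^ 2 * (1 - τ + τ ^ 2))) /
        (τ * (1 - σ * τ + σ ^ 2 * τ ^ 2)) := by
    rw [hδ5, hκ5]
    field_simp
    ring
  have hZ : δ ^ 5 * (κ ^ 5) ^ 2 * τ ^ 5 =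
      (1 - τ) * (1 - τ + τ ^ 2) * ((1 - σ) * (1 - σ + σ ^ 2)) /
        (σ * τ * ((1 - σ * τ) * (1 - σ * τ + σ ^ 2 * τ ^ 2)) ^ 2) := by
    rw [hδ5, hκ5]
    field_simp
  have hψ5 : ψ ^ 5 * (δ ^ 5 * (κ ^ 5) ^ 2 * τ ^ 5) *
      ((1 + κ ^ 5 * τ ^ 5 * (1 + δ ^ 5)) * (1 + κ ^ 5 * (1 + δ ^ 5 * σ ^ 5 * τ ^ 5))) =
      p ^ 5 := by
    have hpow : ψ ^ 5 * (δ ^ 5 * (κ ^ 5) ^ 2 * τ ^ 5) = c ^ 5 * s ^ 5 * p ^ 5 := by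
      linear_combination congrArg (· ^ 5) hψ
    rw [hpow]
    linear_combination
      p ^ 5 * (s ^ 5 * (1 + κ ^ 5 * (1 + δ ^ 5 * σ ^ 5 * τ ^ 5)) * hc - hs)
  rw [hX, hY, hZ, hp] at hψ5
  have h3' : 1 - τ * σ ≠ 0 := by rwa [mul_comm]
  have hC' : 1 - τ * σ + τ ^ 2 * σ ^ 2 ≠ 0 := by rwa [mul_comm τ, mul_comm (τ ^ 2)]
  field_simp at hψ5
  unfold F
  linear_combination -hψ5
end

section
/- Let ψ, σ, τ ∈ ℂ with ψ ≠ 0, στ(1−σ)(1−τ)(1−στ) ≠ 0, (1−σ+σ²)(1−τ+τ²)(1−στ+σ²τ²) ≠ 0, (1−τ(1+σ)+τ²(1−σ+σ²))·(1−σ(1+τ)+σ²(1−τ+τ²)) ≠ 0, and F(σ,τ;ψ) = 0. Then there exist A, B, C, D, E ∈ ℂ with A⁵ = σ⁴(1−σ)(1−τ)(1−στ)(1−τ(1+σ)+τ²(1−σ+σ²)), B⁵ = τ⁴(1−τ)(1−σ)(1−στ)(1−σ(1+τ)+σ²(1−τ+τ²)), C⁵ = τ⁴(1−σ)(1−σ+σ²),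 D⁵ = (1−στ)(1−στ+σ²τ²), E⁵ = σ⁴(1−τ)(1−τ+τ²), such that for all u, v ∈ ℂ: (Au)⁵ + (Bv)⁵ + (−C(σu+v))⁵ + (D(σu+τv))⁵ + (−E(u+τv))⁵ = 5ψ·(Au)·(Bv)·(−C(σu+v))·(D(σu+τv))·(−E(u+τv)); that is, the line x(u,v) = (Au, Bv, −C(σu+v), D(σu+τv), −E(u+τv)) lies in the Dwork quintic M_ψ. -/
/-- Explicit parametrization of the family of lines: if `F(σ,τ;ψ) = 0` (with the relevant
quantities nonvanishing), there are fifth roots `A, B, C, D, E` such that the line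
`x(u,v) = (Au, Bv, −C(σu+v), D(σu+τv), −E(u+τv))` lies in the Dwork quintic `M_ψ`. -/
theorem lines_from_F_zero (ψ σ τ : ℂ) (hψ : ψ ≠ 0)
    (h1 : σ * τ * (1 - σ) * (1 - τ) * (1 - σ * τ) ≠ 0)
    (h2 : (1 - σ + σ ^ 2) * (1 - τ + τ ^ 2) * (1 - σ * τ + σ ^ 2 * τ ^ 2) ≠ 0)
    (h3 : (1 - τ * (1 + σ) + τ ^ 2 * (1 - σ + σ ^ 2)) *
      (1 - σ * (1 + τ) + σ ^ 2 * (1 - τ + τ ^ 2)) ≠ 0)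
    (hF : F σ τ ψ = 0) :
    ∃ A B C D E : ℂ,
      A ^ 5 = σ ^ 4 * (1 - σ) * (1 - τ) * (1 - σ * τ) *
        (1 - τ * (1 + σ) + τ ^ 2 * (1 - σ + σ ^ 2)) ∧
      B ^ 5 = τ ^ 4 * (1 - τ) * (1 - σ) * (1 - σ * τ) *
        (1 - σ * (1 + τ) + σ ^ 2 * (1 - τ + τ ^ 2)) ∧
      C ^ 5 = τ ^ 4 * (1 - σ) * (1 - σ + σ ^ 2) ∧
      D ^ 5 = (1 - σ * τ) * (1 - σ * τ + σ ^ 2 * τ ^ 2) ∧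
      E ^ 5 = σ ^ 4 * (1 - τ) * (1 - τ + τ ^ 2) ∧
      ∀ u v : ℂ,
        (A * u) ^ 5 + (B * v) ^ 5 + (-(C * (σ * u + v))) ^ 5 +
          (D * (σ * u + τ * v)) ^ 5 + (-(E * (u + τ * v))) ^ 5
        = 5 * ψ * (A * u) * (B * v) * (-(C * (σ * u + v))) *
            (D * (σ * u + τ * v)) * (-(E * (u + τ * v))) := by
  obtain ⟨⟨⟨⟨hs, ht⟩, hs'⟩, ht'⟩, hst⟩ :
      (((σ ≠ 0 ∧ τ ≠ 0) ∧ 1 - σ ≠ 0) ∧ 1 - τ ≠ 0) ∧ 1 - σ * τ ≠ 0 := by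
    simpa only [mul_ne_zero_iff] using h1
  obtain ⟨⟨hqs, -⟩, hqst⟩ :
      (1 - σ + σ ^ 2 ≠ 0 ∧ 1 - τ + τ ^ 2 ≠ 0) ∧ 1 - σ * τ + σ ^ 2 * τ ^ 2 ≠ 0 := by
    simpa only [mul_ne_zero_iff] using h2
  obtain ⟨hrt, hrs⟩ := mul_ne_zero_iff.mp h3
  have root (z : ℂ) (hz : z ≠ 0) : ∃ w : ℂ, w ^ 5 = z ∧ w ≠ 0 := by
    obtain ⟨w, hw⟩ := IsAlgClosed.exists_pow_nat_eq z (by norm_num : 0 < 5)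
    exact ⟨w, hw, fun h => hz (by rw [← hw, h]; norm_num)⟩
  obtain ⟨A, hA, hA0⟩ := root (σ ^ 4 * (1 - σ) * (1 - τ) * (1 - σ * τ) *
    (1 - τ * (1 + σ) + τ ^ 2 * (1 - σ + σ ^ 2))) (by simp_all)
  obtain ⟨B, hB, hB0⟩ := root (τ ^ 4 * (1 - τ) * (1 - σ) * (1 - σ * τ) *
    (1 - σ * (1 + τ) + σ ^ 2 * (1 - τ + τ ^ 2))) (by simp_all)
  obtain ⟨C, hC, hC0⟩ := root (τ ^ 4 * (1 - σ) * (1 - σ + σ ^ 2)) (by simp_all)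
  obtain ⟨D, hD, hD0⟩ := root ((1 - σ * τ) * (1 - σ * τ + σ ^ 2 * τ ^ 2)) (by simp_all)
  have hM : ψ * A * B * C * D ≠ 0 := by simp_all
  -- `E` is forced by the product of the five roots; `F = 0` makes its fifth power correct.
  obtain ⟨E, hE⟩ : ∃ E, ψ * A * B * C * D * E =
      2 * σ ^ 2 * τ ^ 2 * (1 - σ) * (1 - τ) * (1 - σ * τ) :=
    ⟨_, mul_div_cancel₀ _ hM⟩
  have hE5 : E ^ 5 = σ ^ 4 * (1 - τ) * (1 - τ + τ ^ 2) := by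
    refine mul_left_cancel₀ (pow_ne_zero 5 hM) ?_
    rw [← mul_pow, hE]
    simp only [mul_pow _ _ 5, hA, hB, hC, hD]
    unfold F at hF
    linear_combination (σ ^ 8 * τ ^ 8 * (1 - σ) ^ 3 * (1 - τ) ^ 3 * (1 - σ * τ) ^ 3) * hF
  refine ⟨A, B, C, D, E, hA, hB, hC, hD, hE5, fun u v => ?_⟩
  linear_combination u ^ 5 * hA + v ^ 5 * hB - (σ * u + v) ^ 5 * hC
    + (σ * u + τ * v) ^ 5 * hD - (u + τ * v) ^ 5 * hE5
    - 5 * u * v * (σ * u + v) * (σ * u + τ * v) * (u + τ * v) * hE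
end

section
/- For every φ ∈ ℂ, the polynomial F₊(σ,τ) = G(σ,τ) + φH(σ,τ) satisfies F₊(1,1) = 0, (∂F₊/∂σ)(1,1) = 0, (∂F₊/∂τ)(1,1) = 0, and there exists c ∈ ℂ with c ≠ 0 such that (∂²F₊/∂σ²)(1,1) = 2c, (∂²F₊/∂σ∂τ)(1,1) = c, (∂²F₊/∂τ²)(1,1) = 2c. In particular, (1,1) is an ordinary double point of the curve F₊ = 0, with quadratic leading term at (1+ε₁, 1+ε₂) proportional to ε₁² + ε₁ε₂ + ε₂² = (ε₁ − ωε₂)(ε₁ − ω²ε₂) where ω is a primitive cube root of unity. -/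
/-- The polynomial `G(σ,τ)`. -/
noncomputable def G (σ τ : ℂ) : ℂ :=
  3 * σ ^ 2 * τ ^ 2 - (1 / 2) * σ * τ * (1 + σ) * (1 + τ) * (1 + σ * τ) +
    (1 - σ + σ ^ 2) * (1 - τ + τ ^ 2) * (1 - σ * τ + σ ^ 2 * τ ^ 2)

/-- The polynomial `H(σ,τ)`. -/
noncomputable def H (σ τ : ℂ) : ℂ :=
  σ * τ * (1 - σ) * (1 - τ) * (1 - σ * τ)

/-- `F₊ = G + φH`. -/
noncomputable def Fplus (φ σ τ : ℂ) : ℂ := G σ τ + φ * H σ τ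

theorem deriv_quartic (a b c d e : ℂ) :
    deriv (fun x : ℂ => a + b * x + c * x ^ 2 + d * x ^ 3 + e * x ^ 4) =
      fun x => b + 2 * c * x + 3 * d * x ^ 2 + 4 * e * x ^ 3 := by
  funext x
  have h := ((((hasDerivAt_const x a).add ((hasDerivAt_id x).const_mul b)).add
    ((hasDerivAt_pow 2 x).const_mul c)).add ((hasDerivAt_pow 3 x).const_mul d)).add
    ((hasDerivAt_pow 4 x).const_mul e)
  refine (h.congr_deriv ?_).deriv
  norm_num
  ring

theorem iteratedDeriv_two_quartic (a b c d e x : ℂ) :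
    iteratedDeriv 2 (fun x : ℂ => a + b * x + c * x ^ 2 + d * x ^ 3 + e * x ^ 4) x =
      2 * c + 6 * d * x + 12 * e * x ^ 2 := by
  have h := congrFun (deriv_quartic b (2 * c) (3 * d) (4 * e) 0) x
  simp only [zero_mul, add_zero, mul_zero] at h
  rw [iteratedDeriv_succ, iteratedDeriv_one, deriv_quartic, h]
  ring

theorem Fplus_one_right (φ : ℂ) :
    (fun σ : ℂ => Fplus φ σ 1) =
      fun σ => 1 + (-3) * σ + 4 * σ ^ 2 + (-3) * σ ^ 3 + 1 * σ ^ 4 := by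
  funext σ
  simp only [Fplus, G, H]
  ring

theorem Fplus_one_left (φ : ℂ) :
    (fun τ : ℂ => Fplus φ 1 τ) =
      fun τ => 1 + (-3) * τ + 4 * τ ^ 2 + (-3) * τ ^ 3 + 1 * τ ^ 4 := by
  funext τ
  simp only [Fplus, G, H]
  ring

theorem deriv_Fplus_right_one (φ : ℂ) :
    (fun σ : ℂ => deriv (fun τ : ℂ => Fplus φ σ τ) 1) =
      fun σ => 1 + (-(9 / 2) - φ) * σ + (8 + 2 * φ) * σ ^ 2 +
        (-(15 / 2) - φ) * σ ^ 3 + 3 * σ ^ 4 := by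
  funext σ
  have h : (fun τ : ℂ => Fplus φ σ τ) = fun τ =>
      (1 - σ + σ ^ 2) +
      (-(σ * (1 + σ) / 2) - (1 - σ + σ ^ 2) * (1 + σ) + φ * σ * (1 - σ)) * τ +
      (3 * σ ^ 2 - σ * (1 + σ) ^ 2 / 2 + (1 - σ + σ ^ 2) * (1 + σ + σ ^ 2) -
        φ * σ * (1 - σ) * (1 + σ)) * τ ^ 2 +
      (-(σ ^ 2 * (1 + σ) / 2) - (1 - σ + σ ^ 2) * (σ + σ ^ 2) +
        φ * σ ^ 2 * (1 - σ)) * τ ^ 3 +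
      (1 - σ + σ ^ 2) * σ ^ 2 * τ ^ 4 := by
    funext τ
    simp only [Fplus, G, H]
    ring
  rw [h, deriv_quartic]
  ring

/-- The point `(1,1)` is an ordinary double point of the curve `F₊ = 0`: the value and
both first partial derivatives vanish there, and the Hessian is a nonzero multiple of
the matrix of `ε₁² + ε₁ε₂ + ε₂²`, which factors as `(ε₁ − ωε₂)(ε₁ − ω²ε₂)` for a
primitive cube root of unity `ω`. -/
theorem Fplus_odp_at_one_one (φ : ℂ) :
    Fplus φ 1 1 = 0 ∧
    deriv (fun σ : ℂ => Fplus φ σ 1) 1 = 0 ∧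
    deriv (fun τ : ℂ => Fplus φ 1 τ) 1 = 0 ∧
    (∃ c : ℂ, c ≠ 0 ∧
      iteratedDeriv 2 (fun σ : ℂ => Fplus φ σ 1) 1 = 2 * c ∧
      deriv (fun σ : ℂ => deriv (fun τ : ℂ => Fplus φ σ τ) 1) 1 = c ∧
      iteratedDeriv 2 (fun τ : ℂ => Fplus φ 1 τ) 1 = 2 * c) ∧
    (∀ ω ε₁ ε₂ : ℂ, ω ^ 2 + ω + 1 = 0 →
      ε₁ ^ 2 + ε₁ * ε₂ + ε₂ ^ 2 = (ε₁ - ω * ε₂) * (ε₁ - ω ^ 2 * ε₂)) := by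
  rw [Fplus_one_right, Fplus_one_left, deriv_Fplus_right_one]
  simp only [deriv_quartic, iteratedDeriv_two_quartic]
  refine ⟨?_, by norm_num, by norm_num, ⟨1, one_ne_zero, by norm_num, by ring, by norm_num⟩, ?_⟩
  · simp only [Fplus, G, H]
    norm_num
  · intro ω ε₁ ε₂ h
    linear_combination (ε₁ * ε₂ - (ω - 1) * ε₂ ^ 2) * h
end

section
/- For all σ, τ ∈ ℂ with τ ≠ 1: G((1−στ)/(1−τ), 1−τ) = (τ/(1−τ))²·G(σ,τ) and H((1−στ)/(1−τ), 1−τ) = −(τ/(1−τ))²·H(σ,τ). -/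
/-- Action of the odd permutation `(13) ∈ S₅`, `(σ,τ) ↦ ((1−στ)/(1−τ), 1−τ)`,
on `G` and `H`. -/
theorem G_H_under_13 (σ τ : ℂ) (hτ : τ ≠ 1) :
    G ((1 - σ * τ) / (1 - τ)) (1 - τ) = (τ / (1 - τ)) ^ 2 * G σ τ ∧
    H ((1 - σ * τ) / (1 - τ)) (1 - τ) = -((τ / (1 - τ)) ^ 2 * H σ τ) := by
  have h : 1 - τ ≠ 0 := sub_ne_zero.mpr hτ.symm
  constructor
  · unfold G
    field_simp
    ring
  · unfold H
    field_simp
    ring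
end

section
/- Let ω ∈ ℂ with ω²+ω+1 = 0. Then the set of common zeros {(σ,τ) ∈ ℂ² : G(σ,τ) = 0 and H(σ,τ) = 0} is exactly the eleven points {(1,1), (0,−ω), (0,−ω²), (1,−ω), (1,−ω²), (−ω,0), (−ω²,0), (−ω,1), (−ω²,1), (−ω,−ω²), (−ω²,−ω)}. -/
theorem one_sub_add_sq_eq_zero_iff {ω : ℂ} (hω : ω ^ 2 + ω + 1 = 0) (x : ℂ) :
    1 - x + x ^ 2 = 0 ↔ x = -ω ∨ x = -ω ^ 2 := by
  have h : 1 - x + x ^ 2 = (x + ω) * (x + ω ^ 2) := by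
    linear_combination (-x - ω + 1) * hω
  rw [h, mul_eq_zero, add_eq_zero_iff_eq_neg, add_eq_zero_iff_eq_neg]

theorem G_comm (σ τ : ℂ) : G σ τ = G τ σ := by
  unfold G
  ring

theorem G_zero_left (τ : ℂ) : G 0 τ = 1 - τ + τ ^ 2 := by
  unfold G
  ring

theorem G_one_left (τ : ℂ) : G 1 τ = (τ - 1) ^ 2 * (1 - τ + τ ^ 2) := by
  unfold G
  ring

theorem G_of_mul_eq_one {σ τ : ℂ} (h : σ * τ = 1) :
    G σ τ = (σ + τ - 1) * (σ + τ - 2) := by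
  have h₁ : (1 - σ + σ ^ 2) * (1 - τ + τ ^ 2) = (σ + τ - 1) ^ 2 := by
    linear_combination (σ * τ - σ - τ) * h
  have h₂ : G σ τ = 3 * (σ * τ) ^ 2 -
      (1 / 2) * (σ * τ) * (1 + σ + τ + σ * τ) * (1 + σ * τ) +
      (1 - σ + σ ^ 2) * (1 - τ + τ ^ 2) * (1 - σ * τ + (σ * τ) ^ 2) := by
    unfold G
    ring
  rw [h₂, h₁, h]
  ring

theorem G_zero_left_eq_zero {ω τ : ℂ} (hω : ω ^ 2 + ω + 1 = 0) (h : G 0 τ = 0) :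
    τ = -ω ∨ τ = -ω ^ 2 := by
  rwa [G_zero_left, one_sub_add_sq_eq_zero_iff hω] at h

theorem G_one_left_eq_zero {ω τ : ℂ} (hω : ω ^ 2 + ω + 1 = 0) (h : G 1 τ = 0) :
    τ = 1 ∨ τ = -ω ∨ τ = -ω ^ 2 := by
  rwa [G_one_left, mul_eq_zero, one_sub_add_sq_eq_zero_iff hω, sq_eq_zero_iff,
    sub_eq_zero] at h

theorem G_eq_zero_of_mul_eq_one {ω σ τ : ℂ} (hω : ω ^ 2 + ω + 1 = 0) (h : σ * τ = 1)
    (hG : G σ τ = 0) :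
    (σ = 1 ∧ τ = 1) ∨ (σ = -ω ∧ τ = -ω ^ 2) ∨ (σ = -ω ^ 2 ∧ τ = -ω) := by
  rw [G_of_mul_eq_one h, mul_eq_zero] at hG
  rcases hG with hs | hs
  · have hσ : 1 - σ + σ ^ 2 = 0 := by linear_combination σ * hs - h
    rcases (one_sub_add_sq_eq_zero_iff hω σ).1 hσ with rfl | rfl
    · exact Or.inr (Or.inl ⟨rfl, by linear_combination hs + hω⟩)
    · exact Or.inr (Or.inr ⟨rfl, by linear_combination hs + hω⟩)
  · have hσ : σ = 1 := by
      rw [← sub_eq_zero, ← sq_eq_zero_iff]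
      linear_combination σ * hs - h
    exact Or.inl ⟨hσ, by linear_combination hs - hσ⟩

/-- The common zero locus of `G` and `H` in `ℂ²` consists of exactly eleven points. -/
theorem common_zeros_G_H (ω : ℂ) (hω : ω ^ 2 + ω + 1 = 0) :
    {p : ℂ × ℂ | G p.1 p.2 = 0 ∧ H p.1 p.2 = 0} =
      {(1, 1), (0, -ω), (0, -ω ^ 2), (1, -ω), (1, -ω ^ 2), (-ω, 0), (-ω ^ 2, 0),
        (-ω, 1), (-ω ^ 2, 1), (-ω, -ω ^ 2), (-ω ^ 2, -ω)} := by
  have h₁ : 1 - -ω + (-ω) ^ 2 = 0 := (one_sub_add_sq_eq_zero_iff hω _).2 (Or.inl rfl)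
  have h₂ : 1 - -ω ^ 2 + (-ω ^ 2) ^ 2 = 0 :=
    (one_sub_add_sq_eq_zero_iff hω _).2 (Or.inr rfl)
  have h₃ : -ω * -ω ^ 2 = 1 := by linear_combination (ω - 1) * hω
  have h₄ : -ω ^ 2 * -ω = 1 := by rw [mul_comm, h₃]
  ext ⟨σ, τ⟩
  simp only [Set.mem_ofPred_eq, Set.mem_insert_iff, Set.mem_singleton_iff, Prod.mk.injEq]
  constructor
  · rintro ⟨hG, hH⟩
    simp only [H, mul_eq_zero, sub_eq_zero] at hH
    rcases hH with (((rfl | rfl) | rfl) | rfl) | h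
    · rcases G_zero_left_eq_zero hω hG with rfl | rfl <;> simp
    · rw [G_comm] at hG
      rcases G_zero_left_eq_zero hω hG with rfl | rfl <;> simp
    · rcases G_one_left_eq_zero hω hG with rfl | rfl | rfl <;> simp
    · rw [G_comm] at hG
      rcases G_one_left_eq_zero hω hG with rfl | rfl | rfl <;> simp
    · rcases G_eq_zero_of_mul_eq_one hω h.symm hG with
        ⟨rfl, rfl⟩ | ⟨rfl, rfl⟩ | ⟨rfl, rfl⟩ <;> simp
  · rintro (⟨rfl, rfl⟩ | ⟨rfl, rfl⟩ | ⟨rfl, rfl⟩ | ⟨rfl, rfl⟩ | ⟨rfl, rfl⟩ | ⟨rfl, rfl⟩ |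
      ⟨rfl, rfl⟩ | ⟨rfl, rfl⟩ | ⟨rfl, rfl⟩ | ⟨rfl, rfl⟩ | ⟨rfl, rfl⟩)
    · exact ⟨by simp [G_one_left], by simp [H]⟩
    · exact ⟨by rw [G_zero_left, h₁], by simp [H]⟩
    · exact ⟨by rw [G_zero_left, h₂], by simp [H]⟩
    · exact ⟨by rw [G_one_left, h₁, mul_zero], by simp [H]⟩
    · exact ⟨by rw [G_one_left, h₂, mul_zero], by simp [H]⟩
    · exact ⟨by rw [G_comm, G_zero_left, h₁], by simp [H]⟩
    · exact ⟨by rw [G_comm, G_zero_left, h₂], by simp [H]⟩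
    · exact ⟨by rw [G_comm, G_one_left, h₁, mul_zero], by simp [H]⟩
    · exact ⟨by rw [G_comm, G_one_left, h₂, mul_zero], by simp [H]⟩
    · exact ⟨by rw [G_of_mul_eq_one h₃]; linear_combination (ω ^ 2 + ω + 2) * hω,
        by rw [H, h₃, sub_self, mul_zero]⟩
    · exact ⟨by rw [G_of_mul_eq_one h₄]; linear_combination (ω ^ 2 + ω + 2) * hω,
        by rw [H, h₄, sub_self, mul_zero]⟩
end

section
/- For all x₁, x₂, x₃, x₄, x₅ ∈ ℂ, with sᵢ denoting the i-th elementary symmetric polynomial in x₁,…,x₅: x₁⁵ + x₂⁵ + x₃⁵ + x₄⁵ + x₅⁵ − 5x₁x₂x₃x₄x₅ = −5·( s₂s₃ + s₁(s₄ − s₂² − s₁s₃ + s₁²s₂ − (1/5)s₁⁴) ). In particular, the Dwork quintic M₁ (case ψ = 1) is defined by s₂s₃ + s₁(s₄ − s₂² − s₁s₃ + s₁²s₂ − (1/5)s₁⁴) = 0, so the hyperplane s₁ = 0 cuts M₁ in the surface s₂s₃ = 0. -/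
/-- The Fermat quintic minus `5·(product of the coordinates)` expressed in elementary
symmetric polynomials: the Dwork quintic `M₁` is defined by
`s₂s₃ + s₁(s₄ − s₂² − s₁s₃ + s₁²s₂ − (1/5)s₁⁴) = 0`, and the hyperplane `s₁ = 0`
cuts `M₁` in the surface `s₂s₃ = 0`. -/
theorem dwork_M1_symmetric_functions (x₁ x₂ x₃ x₄ x₅ s₁ s₂ s₃ s₄ : ℂ)
    (hs₁ : s₁ = x₁ + x₂ + x₃ + x₄ + x₅)
    (hs₂ : s₂ = x₁ * x₂ + x₁ * x₃ + x₁ * x₄ + x₁ * x₅ + x₂ * x₃ + x₂ * x₄ + x₂ * x₅ +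
      x₃ * x₄ + x₃ * x₅ + x₄ * x₅)
    (hs₃ : s₃ = x₁ * x₂ * x₃ + x₁ * x₂ * x₄ + x₁ * x₂ * x₅ + x₁ * x₃ * x₄ +
      x₁ * x₃ * x₅ + x₁ * x₄ * x₅ + x₂ * x₃ * x₄ + x₂ * x₃ * x₅ + x₂ * x₄ * x₅ +
      x₃ * x₄ * x₅)
    (hs₄ : s₄ = x₁ * x₂ * x₃ * x₄ + x₁ * x₂ * x₃ * x₅ + x₁ * x₂ * x₄ * x₅ +
      x₁ * x₃ * x₄ * x₅ + x₂ * x₃ * x₄ * x₅) :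
    (x₁ ^ 5 + x₂ ^ 5 + x₃ ^ 5 + x₄ ^ 5 + x₅ ^ 5 - 5 * (x₁ * x₂ * x₃ * x₄ * x₅) =
      -5 * (s₂ * s₃ + s₁ * (s₄ - s₂ ^ 2 - s₁ * s₃ + s₁ ^ 2 * s₂ - (1 / 5) * s₁ ^ 4))) ∧
    (s₁ = 0 →
      (x₁ ^ 5 + x₂ ^ 5 + x₃ ^ 5 + x₄ ^ 5 + x₅ ^ 5 - 5 * (x₁ * x₂ * x₃ * x₄ * x₅) = 0 ↔
        s₂ * s₃ = 0)) := by
  have key : x₁ ^ 5 + x₂ ^ 5 + x₃ ^ 5 + x₄ ^ 5 + x₅ ^ 5 - 5 * (x₁ * x₂ * x₃ * x₄ * x₅) =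
      -5 * (s₂ * s₃ + s₁ * (s₄ - s₂ ^ 2 - s₁ * s₃ + s₁ ^ 2 * s₂ - (1 / 5) * s₁ ^ 4)) := by
    subst hs₁ hs₂ hs₃ hs₄
    ring
  refine ⟨key, fun h => ?_⟩
  rw [key, h]
  simp
end

section
/- Let ω ∈ ℂ with ω²+ω+1 = 0 and let b ∈ ℂ. Define ℓ(u,v) = (u+v, ωu+v, ω²u+v, bv, −(b+3)v) ∈ ℂ⁵. Then the sum of the five coordinates of ℓ(u,v) is 0 for all u, v ∈ ℂ; and the second elementary symmetric polynomial of the five coordinates of ℓ(u,v) vanishes for all u, v ∈ ℂ if and only if b² + 3b + 6 = 0. Consequently the line ℓ lies in the quadric surface Z = {s₁ = s₂ = 0} ⊂ M₁ exactly when b = (−3 ± √(−15))/2. -/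
/-- First elementary symmetric polynomial of the five coordinates of the line
`ℓ(u,v) = (u+v, ωu+v, ω²u+v, bv, −(b+3)v)`. -/
noncomputable def lineE1 (ω b u v : ℂ) : ℂ :=
  (u + v) + (ω * u + v) + (ω ^ 2 * u + v) + b * v + (-(b + 3) * v)

/-- Second elementary symmetric polynomial of the five coordinates of the line
`ℓ(u,v) = (u+v, ωu+v, ω²u+v, bv, −(b+3)v)`. -/
noncomputable def lineE2 (ω b u v : ℂ) : ℂ :=
  (u + v) * (ω * u + v) + (u + v) * (ω ^ 2 * u + v) + (u + v) * (b * v) +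
    (u + v) * (-(b + 3) * v) + (ω * u + v) * (ω ^ 2 * u + v) + (ω * u + v) * (b * v) +
    (ω * u + v) * (-(b + 3) * v) + (ω ^ 2 * u + v) * (b * v) +
    (ω ^ 2 * u + v) * (-(b + 3) * v) + (b * v) * (-(b + 3) * v)

theorem lineE1_eq_zero {ω : ℂ} (hω : ω ^ 2 + ω + 1 = 0) (b u v : ℂ) : lineE1 ω b u v = 0 := by
  unfold lineE1
  linear_combination u * hω

theorem lineE2_eq {ω : ℂ} (hω : ω ^ 2 + ω + 1 = 0) (b u v : ℂ) :
    lineE2 ω b u v = -(b ^ 2 + 3 * b + 6) * v ^ 2 := by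
  unfold lineE2
  linear_combination (ω * u ^ 2 - u * v) * hω

theorem forall_lineE2_eq_zero_iff {ω : ℂ} (hω : ω ^ 2 + ω + 1 = 0) (b : ℂ) :
    (∀ u v : ℂ, lineE2 ω b u v = 0) ↔ b ^ 2 + 3 * b + 6 = 0 := by
  simp only [lineE2_eq hω]
  refine ⟨fun h => ?_, fun h u v => by rw [h]; ring⟩
  linear_combination -h 0 1

theorem quadratic_eq_zero_iff_of_sq_eq {δ : ℂ} (hδ : δ ^ 2 = -15) (b : ℂ) :
    b ^ 2 + 3 * b + 6 = 0 ↔ b = (-3 + δ) / 2 ∨ b = (-3 - δ) / 2 := by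
  have h : b ^ 2 + 3 * b + 6 = (b - (-3 + δ) / 2) * (b - (-3 - δ) / 2) := by
    linear_combination hδ / 4
  rw [h, mul_eq_zero, sub_eq_zero, sub_eq_zero]

/-- The line `ℓ(u,v) = (u+v, ωu+v, ω²u+v, bv, −(b+3)v)` always satisfies `s₁ = 0`;
it satisfies `s₂ = 0` identically iff `b² + 3b + 6 = 0`, i.e. iff
`b = (−3 ± √(−15))/2`, and hence lies in the quadric `Z = {s₁ = s₂ = 0} ⊂ M₁`
exactly for these two values of `b`. -/
theorem van_geemen_lines_on_quadric (ω b : ℂ) (hω : ω ^ 2 + ω + 1 = 0) :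
    (∀ u v : ℂ, lineE1 ω b u v = 0) ∧
    ((∀ u v : ℂ, lineE2 ω b u v = 0) ↔ b ^ 2 + 3 * b + 6 = 0) ∧
    (∀ δ : ℂ, δ ^ 2 = -15 →
      ((∀ u v : ℂ, lineE2 ω b u v = 0) ↔ (b = (-3 + δ) / 2 ∨ b = (-3 - δ) / 2))) :=
  ⟨lineE1_eq_zero hω b, forall_lineE2_eq_zero_iff hω b, fun _ hδ =>
    (forall_lineE2_eq_zero_iff hω b).trans (quadratic_eq_zero_iff_of_sq_eq hδ b)⟩
end

section
/- Let ω ∈ ℂ with ω²+ω+1 = 0. There exists φ ∈ ℂ with φ² = −3/4 such that for all σ, τ ∈ ℂ: G(σ,τ) + φH(σ,τ) = (σ+ω²)(τ+ω²)(στ+ω)(στ+ωσ+ω²)(στ+ωτ+ω²). -/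
/-- For a value of `φ` with `φ² = −3/4` (the case `ψ = ∞` of the Dwork pencil),
`F₊ = G + φH` factors into five irreducible components, one for each coordinate
hyperplane. -/
theorem Fplus_factors_at_psi_infinity (ω : ℂ) (hω : ω ^ 2 + ω + 1 = 0) :
    ∃ φ : ℂ, φ ^ 2 = -(3 / 4) ∧
      ∀ σ τ : ℂ, G σ τ + φ * H σ τ =
        (σ + ω ^ 2) * (τ + ω ^ 2) * (σ * τ + ω) * (σ * τ + ω * σ + ω ^ 2) *
          (σ * τ + ω * τ + ω ^ 2) := by
  refine ⟨ω + 1 / 2, by linear_combination hω, fun σ τ => ?_⟩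
  unfold G H
  grind
end

section
/- Let ω ∈ ℂ with ω²+ω+1 = 0 and let φ ∈ ℂ with φ² = 125/4. Define the rational function R(z,φ) = (20z⁴ + (15−2φ)z³ + 3(5+2φ)z² − (15−2φ)z + 20)/(6z(5z²+2φz−5)). Then for every z ∈ ℂ such that z ≠ 0, 5z² + 2φz − 5 ≠ 0, 5(−ω²z)² − 2φ(−ω²z) − 5 ≠ 0, and R(−ω²z, −φ) ≠ 0, one has G(R(z,φ), 1/R(−ω²z,−φ)) + φ·H(R(z,φ), 1/R(−ω²z,−φ)) = 0; i.e., z ↦ (σ,τ) = (R(z,φ), 1/R(−ω²z,−φ)) parametrizes the curve F₊ = G + φH = 0. -/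
/-- The rational function `R(z,φ)` parametrizing the rational curve `F₊ = 0`
at the conifold values `φ² = 125/4`. -/
noncomputable def R (z φ : ℂ) : ℂ :=
  (20 * z ^ 4 + (15 - 2 * φ) * z ^ 3 + 3 * (5 + 2 * φ) * z ^ 2 - (15 - 2 * φ) * z + 20) /
    (6 * z * (5 * z ^ 2 + 2 * φ * z - 5))

/-- The element with coordinates `a, b, c, d` in the basis `1, g, u, g * u`. -/
def coords (g u a b c d : ℂ) : ℂ := a + b * g + c * u + d * (g * u)

/-- Multiplication in coordinates, when `g` is a root of `X² - X - 1` and `u` is a root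
of `X² - X + 1`. -/
lemma coords_mul {g u : ℂ} (hg : g ^ 2 = g + 1) (hu : u ^ 2 = u - 1)
    (a b c d a' b' c' d' : ℂ) :
    coords g u a b c d * coords g u a' b' c' d' =
      coords g u (a * a' + b * b' - c * c' - d * d')
        (a * b' + b * a' + b * b' - c * d' - d * c' - d * d')
        (a * c' + c * a' + c * c' + b * d' + d * b' + d * d')
        (a * d' + d * a' + b * c' + c * b' + b * d' + d * b' + c * d' + d * c' + d * d') := by
  unfold coords
  linear_combination (b * b' + (b * d' + d * b') * u + d * d' * u ^ 2) * hg +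
    (c * c' + (c * d' + d * c') * g + d * d' * (g + 1)) * hu

/-- The curve `2 (G + φ H) = 0` with `φ = 5 (2 g - 1) / 2`, `σ = A / B` and `τ = C / D`,
with denominators cleared. -/
def clearedCurve (g A B C D : ℂ) : ℂ :=
  A * C * (B * D) * (6 * (A * C * (B * D)) -
      (A * C + B * D) * (A * C + B * D + (A * D + B * C)) +
      5 * (2 * g - 1) * ((A * C + B * D - (A * D + B * C)) * (B * D - A * C))) +
    2 * (((A * C + B * D) * (A * C + B * D) + (A * D + B * C) * (A * D + B * C) -
        (A * C + B * D) * (A * D + B * C) - 3 * (A * C * (B * D))) *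
      ((A * C + B * D) * (A * C + B * D) - 3 * (A * C * (B * D))))

lemma G_add_H_of_clearedCurve {g A B C D : ℂ} (hB : B ≠ 0) (hD : D ≠ 0)
    (h : clearedCurve g A B C D = 0) :
    G (A / B) (C / D) + 5 * (2 * g - 1) / 2 * H (A / B) (C / D) = 0 := by
  have key : G (A / B) (C / D) + 5 * (2 * g - 1) / 2 * H (A / B) (C / D) =
      clearedCurve g A B C D / (2 * B ^ 4 * D ^ 4) := by
    unfold G H clearedCurve
    field_simp
    ring
  rw [key, h, zero_div]

set_option maxHeartbeats 1000000 in
/-- The vanishing of `clearedCurve` along the parametrization, in terms of `m = ABCD`,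
`S = AC + BD`, `T = AD + BC` and `d = BD - AC`. -/
lemma clearedCurve_eq_zero {g u m S T d : ℂ} (hg : g ^ 2 = g + 1) (hu : u ^ 2 = u - 1)
    (z : ℂ)
    (hm : m = coords g u
      (54 * z ^ 13 - 81 * z ^ 12 - 486 * z ^ 11 - 405 * z ^ 10 - 162 * z ^ 9 - 162 * z ^ 7 +
        405 * z ^ 6 - 486 * z ^ 5 + 81 * z ^ 4 + 54 * z ^ 3)
      (-54 * z ^ 13 - 108 * z ^ 12 - 162 * z ^ 10 - 648 * z ^ 9 - 648 * z ^ 7 + 162 * z ^ 6 +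
        108 * z ^ 4 - 54 * z ^ 3)
      (36 * z ^ 14 - 108 * z ^ 12 + 72 * z ^ 11 + 567 * z ^ 10 + 972 * z ^ 9 - 378 * z ^ 8 -
        810 * z ^ 7 + 162 * z ^ 6 + 414 * z ^ 5 - 189 * z ^ 4 - 54 * z ^ 3 + 36 * z ^ 2)
      (54 * z ^ 13 + 216 * z ^ 12 + 342 * z ^ 11 - 162 * z ^ 10 + 648 * z ^ 7 - 324 * z ^ 6 -
        342 * z ^ 5 + 108 * z ^ 4))
    (hS : S = coords g u
      (-6 * z ^ 7 - 15 * z ^ 6 - 24 * z ^ 5 + 54 * z ^ 4 + 21 * z ^ 3 - 12 * z ^ 2 - 6 * z)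
      (12 * z ^ 6 - 18 * z ^ 3 + 24 * z ^ 2)
      (-6 * z ^ 7 + 12 * z ^ 6 + 21 * z ^ 5 - 54 * z ^ 4 - 24 * z ^ 3 + 15 * z ^ 2 - 6 * z)
      (-24 * z ^ 6 - 18 * z ^ 5 - 12 * z ^ 2))
    (hT : T = coords g u
      (-2 * z ^ 7 - 16 * z ^ 6 - 12 * z ^ 5 + 68 * z ^ 4 + 20 * z ^ 3 - 6 * z ^ 2 - 4 * z + 4)
      (-2 * z ^ 7 + 6 * z ^ 6 - 28 * z ^ 3 + 12 * z ^ 2 + 2 * z)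
      (-4 * z ^ 8 - 4 * z ^ 7 + 6 * z ^ 6 + 20 * z ^ 5 - 68 * z ^ 4 - 12 * z ^ 3 + 16 * z ^ 2 -
        2 * z)
      (2 * z ^ 7 - 12 * z ^ 6 - 28 * z ^ 5 - 6 * z ^ 2 - 2 * z))
    (hd : d = coords g u
      (6 * z ^ 7 + 9 * z ^ 6 + 6 * z ^ 4 + 9 * z ^ 3 - 6 * z)
      (-18 * z ^ 6 - 12 * z ^ 4)
      (-6 * z ^ 7 + 9 * z ^ 5 - 6 * z ^ 4 - 9 * z ^ 2 + 6 * z)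
      (12 * z ^ 4 + 18 * z ^ 2)) :
    m * (6 * m - S * (S + T) + 5 * (2 * g - 1) * ((S - T) * d)) +
      2 * ((S * S + T * T - S * T - 3 * m) * (S * S - 3 * m)) = 0 := by
  have hfive : 5 * (2 * g - 1) = coords g u (-5) 10 0 0 := by unfold coords; ring
  have hSS : S * S =
      coords g u
      (324 * z ^ 13 + 189 * z ^ 12 - 1944 * z ^ 11 - 1053 * z ^ 10 - 486 * z ^ 9 - 486 * z ^ 7 +
        1053 * z ^ 6 - 1944 * z ^ 5 - 189 * z ^ 4 + 324 * z ^ 3)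
      (-432 * z ^ 13 - 432 * z ^ 12 - 648 * z ^ 10 - 2916 * z ^ 9 - 2916 * z ^ 7 + 648 * z ^ 6 +
        432 * z ^ 4 - 432 * z ^ 3)
      (108 * z ^ 14 - 108 * z ^ 13 - 432 * z ^ 12 + 378 * z ^ 11 + 1701 * z ^ 10 + 3888 * z ^ 9 -
        2268 * z ^ 8 - 3402 * z ^ 7 + 648 * z ^ 6 + 1566 * z ^ 5 - 243 * z ^ 4 - 216 * z ^ 3 +
        108 * z ^ 2)
      (432 * z ^ 13 + 864 * z ^ 12 + 1188 * z ^ 11 - 648 * z ^ 10 + 2916 * z ^ 7 - 1296 * z ^ 6 -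
        1188 * z ^ 5 + 432 * z ^ 4) := by
    rw [hS, coords_mul hg hu]; congr 1 <;> ring
  have hST : S * T =
      coords g u
      (-24 * z ^ 15 + 36 * z ^ 14 + 318 * z ^ 13 + 96 * z ^ 12 - 1926 * z ^ 11 - 1614 * z ^ 10 -
        396 * z ^ 9 - 396 * z ^ 7 + 1614 * z ^ 6 - 1926 * z ^ 5 - 96 * z ^ 4 + 318 * z ^ 3 -
        36 * z ^ 2 - 24 * z)
      (-72 * z ^ 14 - 270 * z ^ 13 - 408 * z ^ 12 - 498 * z ^ 10 - 2916 * z ^ 9 - 2916 * z ^ 7 +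
        498 * z ^ 6 + 408 * z ^ 4 - 270 * z ^ 3 + 72 * z ^ 2)
      (48 * z ^ 15 + 72 * z ^ 14 + 48 * z ^ 13 - 408 * z ^ 12 + 414 * z ^ 11 + 2112 * z ^ 10 +
        3708 * z ^ 9 - 2646 * z ^ 8 - 3312 * z ^ 7 + 498 * z ^ 6 + 1512 * z ^ 5 - 312 * z ^ 4 -
        366 * z ^ 3 + 108 * z ^ 2 - 24 * z)
      (36 * z ^ 14 + 270 * z ^ 13 + 816 * z ^ 12 + 1098 * z ^ 11 - 498 * z ^ 10 + 2916 * z ^ 7 -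
        996 * z ^ 6 - 1098 * z ^ 5 + 408 * z ^ 4 - 36 * z ^ 2) := by
    rw [hS, hT, coords_mul hg hu]; congr 1 <;> ring
  have hTT : T * T =
      coords g u
      (-16 * z ^ 16 - 32 * z ^ 15 + 36 * z ^ 14 + 296 * z ^ 13 - 112 * z ^ 12 - 1440 * z ^ 11 -
        2336 * z ^ 10 + 368 * z ^ 9 + 368 * z ^ 7 + 2336 * z ^ 6 - 1440 * z ^ 5 + 112 * z ^ 4 +
        296 * z ^ 3 - 36 * z ^ 2 - 32 * z + 16)
      (16 * z ^ 15 - 72 * z ^ 14 - 280 * z ^ 13 - 300 * z ^ 12 - 336 * z ^ 10 - 3472 * z ^ 9 -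
        3472 * z ^ 7 + 336 * z ^ 6 + 300 * z ^ 4 - 280 * z ^ 3 + 72 * z ^ 2 + 16 * z)
      (16 * z ^ 16 + 48 * z ^ 15 + 108 * z ^ 14 + 16 * z ^ 13 - 300 * z ^ 12 + 2672 * z ^ 10 +
        2736 * z ^ 9 - 3024 * z ^ 8 - 3104 * z ^ 7 + 336 * z ^ 6 + 1440 * z ^ 5 - 412 * z ^ 4 -
        312 * z ^ 3 + 144 * z ^ 2 - 16 * z)
      (36 * z ^ 14 + 280 * z ^ 13 + 600 * z ^ 12 + 1440 * z ^ 11 - 336 * z ^ 10 + 3472 * z ^ 7 -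
        672 * z ^ 6 - 1440 * z ^ 5 + 300 * z ^ 4 - 36 * z ^ 2 - 16 * z) := by
    rw [hT, coords_mul hg hu]; congr 1 <;> ring
  have hE : S - T =
      coords g u
      (-4 * z ^ 7 + z ^ 6 - 12 * z ^ 5 - 14 * z ^ 4 + z ^ 3 - 6 * z ^ 2 - 2 * z - 4)
      (2 * z ^ 7 + 6 * z ^ 6 + 10 * z ^ 3 + 12 * z ^ 2 - 2 * z)
      (4 * z ^ 8 - 2 * z ^ 7 + 6 * z ^ 6 + z ^ 5 + 14 * z ^ 4 - 12 * z ^ 3 - z ^ 2 - 4 * z)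
      (-2 * z ^ 7 - 12 * z ^ 6 + 10 * z ^ 5 - 6 * z ^ 2 + 2 * z) := by
    rw [hS, hT]; unfold coords; ring
  have hX : 5 * (2 * g - 1) * ((S - T) * d) =
      coords g u
      (-120 * z ^ 15 + 180 * z ^ 14 + 510 * z ^ 13 + 195 * z ^ 12 + 4950 * z ^ 11 + 1635 * z ^ 10 +
        3690 * z ^ 9 + 3690 * z ^ 7 - 1635 * z ^ 6 + 4950 * z ^ 5 - 195 * z ^ 4 + 510 * z ^ 3 -
        180 * z ^ 2 - 120 * z)
      (240 * z ^ 15 - 360 * z ^ 14 - 570 * z ^ 13 - 1440 * z ^ 12 - 270 * z ^ 10 - 4680 * z ^ 9 -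
        4680 * z ^ 7 + 270 * z ^ 6 + 1440 * z ^ 4 - 570 * z ^ 3 + 360 * z ^ 2 + 240 * z)
      (-1140 * z ^ 14 - 60 * z ^ 13 - 1440 * z ^ 12 - 2280 * z ^ 11 - 1365 * z ^ 10 - 2700 * z ^ 9 +
        2250 * z ^ 8 - 990 * z ^ 7 + 270 * z ^ 6 - 2670 * z ^ 5 - 1245 * z ^ 4 - 450 * z ^ 3 -
        960 * z ^ 2 + 120 * z)
      (180 * z ^ 14 + 570 * z ^ 13 + 2880 * z ^ 12 - 390 * z ^ 11 - 270 * z ^ 10 + 4680 * z ^ 7 -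
        540 * z ^ 6 + 390 * z ^ 5 + 1440 * z ^ 4 - 180 * z ^ 2 - 240 * z) := by
    rw [hE, hd, hfive, coords_mul hg hu, coords_mul hg hu]; congr 1 <;> ring
  have hY : 6 * m - S * (S + T) + 5 * (2 * g - 1) * ((S - T) * d) =
      coords g u
      (-96 * z ^ 15 + 144 * z ^ 14 + 192 * z ^ 13 - 576 * z ^ 12 + 5904 * z ^ 11 + 1872 * z ^ 10 +
        3600 * z ^ 9 + 3600 * z ^ 7 - 1872 * z ^ 6 + 5904 * z ^ 5 + 576 * z ^ 4 + 192 * z ^ 3 -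
        144 * z ^ 2 - 96 * z)
      (240 * z ^ 15 - 288 * z ^ 14 - 192 * z ^ 13 - 1248 * z ^ 12 - 96 * z ^ 10 - 2736 * z ^ 9 -
        2736 * z ^ 7 + 96 * z ^ 6 + 1248 * z ^ 4 - 192 * z ^ 3 + 288 * z ^ 2 + 240 * z)
      (-48 * z ^ 15 - 1104 * z ^ 14 - 1248 * z ^ 12 - 2640 * z ^ 11 - 1776 * z ^ 10 - 4464 * z ^ 9 +
        4896 * z ^ 8 + 864 * z ^ 7 + 96 * z ^ 6 - 3264 * z ^ 5 - 1824 * z ^ 4 - 192 * z ^ 3 -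
        960 * z ^ 2 + 144 * z)
      (144 * z ^ 14 + 192 * z ^ 13 + 2496 * z ^ 12 - 624 * z ^ 11 - 96 * z ^ 10 + 2736 * z ^ 7 -
        192 * z ^ 6 + 624 * z ^ 5 + 1248 * z ^ 4 - 144 * z ^ 2 - 240 * z) := by
    rw [mul_add, hX, hSS, hST, hm]; unfold coords; ring
  have hU : S * S + T * T - S * T - 3 * m =
      coords g u
      (-16 * z ^ 16 - 8 * z ^ 15 + 140 * z ^ 13 + 224 * z ^ 12 - 560 * z ^ 10 + 764 * z ^ 9 +
        764 * z ^ 7 + 560 * z ^ 6 - 224 * z ^ 4 + 140 * z ^ 3 - 8 * z + 16)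
      (16 * z ^ 15 - 280 * z ^ 13 - 1528 * z ^ 9 - 1528 * z ^ 7 - 280 * z ^ 3 + 16 * z)
      (16 * z ^ 16 + 36 * z ^ 14 - 140 * z ^ 13 - 252 * z ^ 11 + 560 * z ^ 10 - 1512 * z ^ 8 -
        764 * z ^ 7 + 252 * z ^ 5 + 224 * z ^ 4 + 36 * z ^ 2 + 8 * z)
      (280 * z ^ 13 + 504 * z ^ 11 + 1528 * z ^ 7 - 504 * z ^ 5 - 16 * z) := by
    rw [hSS, hTT, hST, hm]; unfold coords; ring
  have hV : S * S - 3 * m =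
      coords g u
      (162 * z ^ 13 + 432 * z ^ 12 - 486 * z ^ 11 + 162 * z ^ 10 - 162 * z ^ 6 - 486 * z ^ 5 -
        432 * z ^ 4 + 162 * z ^ 3)
      (-270 * z ^ 13 - 108 * z ^ 12 - 162 * z ^ 10 - 972 * z ^ 9 - 972 * z ^ 7 + 162 * z ^ 6 +
        108 * z ^ 4 - 270 * z ^ 3)
      (-108 * z ^ 13 - 108 * z ^ 12 + 162 * z ^ 11 + 972 * z ^ 9 - 1134 * z ^ 8 - 972 * z ^ 7 +
        162 * z ^ 6 + 324 * z ^ 5 + 324 * z ^ 4 - 54 * z ^ 3)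
      (270 * z ^ 13 + 216 * z ^ 12 + 162 * z ^ 11 - 162 * z ^ 10 + 972 * z ^ 7 - 324 * z ^ 6 -
        162 * z ^ 5 + 108 * z ^ 4) := by
    rw [hSS, hm]; unfold coords; ring
  rw [hY, hU, hV, hm, coords_mul hg hu, coords_mul hg hu]
  unfold coords
  ring

lemma clearedCurve_parametrization {g u A B C D : ℂ} (hg : g ^ 2 = g + 1) (hu : u ^ 2 = u - 1)
    (z : ℂ)
    (hA : A = coords g u
      (2 * z ^ 4 + 2 * z ^ 3 - 2 * z + 2)
      (-z ^ 3 + 3 * z ^ 2 + z) 0 0)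
    (hB : B = coords g u
      (3 * z ^ 3 - 3 * z ^ 2 - 3 * z)
      (6 * z ^ 2) 0 0)
    (hC : C = coords g u
      (-3 * z ^ 3 - 3 * z ^ 2)
      (6 * z ^ 2)
      (3 * z ^ 2 - 3 * z)
      (-6 * z ^ 2))
    (hD : D = coords g u
      (-z ^ 3 - 3 * z ^ 2 + 2)
      (-z ^ 3 + 3 * z ^ 2)
      (-2 * z ^ 4 + 3 * z ^ 2 - z)
      (-3 * z ^ 2 - z)) :
    clearedCurve g A B C D = 0 := by
  have hAC : A * C =
      coords g u
      (-6 * z ^ 7 - 12 * z ^ 6 - 12 * z ^ 5 + 24 * z ^ 4 + 6 * z ^ 3 - 6 * z ^ 2)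
      (15 * z ^ 6 + 6 * z ^ 4 - 9 * z ^ 3 + 12 * z ^ 2)
      (6 * z ^ 6 + 6 * z ^ 5 - 24 * z ^ 4 - 12 * z ^ 3 + 12 * z ^ 2 - 6 * z)
      (-12 * z ^ 6 - 9 * z ^ 5 - 6 * z ^ 4 - 15 * z ^ 2) := by
    rw [hA, hC, coords_mul hg hu]; congr 1 <;> ring
  have hBD : B * D =
      coords g u
      (-3 * z ^ 6 - 12 * z ^ 5 + 30 * z ^ 4 + 15 * z ^ 3 - 6 * z ^ 2 - 6 * z)
      (-3 * z ^ 6 - 6 * z ^ 4 - 9 * z ^ 3 + 12 * z ^ 2)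
      (-6 * z ^ 7 + 6 * z ^ 6 + 15 * z ^ 5 - 30 * z ^ 4 - 12 * z ^ 3 + 3 * z ^ 2)
      (-12 * z ^ 6 - 9 * z ^ 5 + 6 * z ^ 4 + 3 * z ^ 2) := by
    rw [hB, hD, coords_mul hg hu]; congr 1 <;> ring
  have hAD : A * D =
      coords g u
      (-2 * z ^ 7 - 7 * z ^ 6 - 12 * z ^ 5 + 14 * z ^ 4 + 11 * z ^ 3 - 6 * z ^ 2 - 4 * z + 4)
      (-2 * z ^ 7 + 6 * z ^ 6 - 10 * z ^ 3 + 12 * z ^ 2 + 2 * z)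
      (-4 * z ^ 8 - 4 * z ^ 7 + 6 * z ^ 6 + 11 * z ^ 5 - 14 * z ^ 4 - 12 * z ^ 3 + 7 * z ^ 2 -
        2 * z)
      (2 * z ^ 7 - 12 * z ^ 6 - 10 * z ^ 5 - 6 * z ^ 2 - 2 * z) := by
    rw [hA, hD, coords_mul hg hu]; congr 1 <;> ring
  have hBC : B * C =
      coords g u
      (-9 * z ^ 6 + 54 * z ^ 4 + 9 * z ^ 3)
      (-18 * z ^ 3)
      (9 * z ^ 5 - 54 * z ^ 4 + 9 * z ^ 2)
      (-18 * z ^ 5) := by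
    rw [hB, hC, coords_mul hg hu]; congr 1 <;> ring
  have hm : A * C * (B * D) =
      coords g u
      (54 * z ^ 13 - 81 * z ^ 12 - 486 * z ^ 11 - 405 * z ^ 10 - 162 * z ^ 9 - 162 * z ^ 7 +
        405 * z ^ 6 - 486 * z ^ 5 + 81 * z ^ 4 + 54 * z ^ 3)
      (-54 * z ^ 13 - 108 * z ^ 12 - 162 * z ^ 10 - 648 * z ^ 9 - 648 * z ^ 7 + 162 * z ^ 6 +
        108 * z ^ 4 - 54 * z ^ 3)
      (36 * z ^ 14 - 108 * z ^ 12 + 72 * z ^ 11 + 567 * z ^ 10 + 972 * z ^ 9 - 378 * z ^ 8 -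
        810 * z ^ 7 + 162 * z ^ 6 + 414 * z ^ 5 - 189 * z ^ 4 - 54 * z ^ 3 + 36 * z ^ 2)
      (54 * z ^ 13 + 216 * z ^ 12 + 342 * z ^ 11 - 162 * z ^ 10 + 648 * z ^ 7 - 324 * z ^ 6 -
        342 * z ^ 5 + 108 * z ^ 4) := by
    rw [hAC, hBD, coords_mul hg hu]; congr 1 <;> ring
  have hS : A * C + B * D =
      coords g u
      (-6 * z ^ 7 - 15 * z ^ 6 - 24 * z ^ 5 + 54 * z ^ 4 + 21 * z ^ 3 - 12 * z ^ 2 - 6 * z)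
      (12 * z ^ 6 - 18 * z ^ 3 + 24 * z ^ 2)
      (-6 * z ^ 7 + 12 * z ^ 6 + 21 * z ^ 5 - 54 * z ^ 4 - 24 * z ^ 3 + 15 * z ^ 2 - 6 * z)
      (-24 * z ^ 6 - 18 * z ^ 5 - 12 * z ^ 2) := by
    rw [hAC, hBD]; unfold coords; ring
  have hT : A * D + B * C =
      coords g u
      (-2 * z ^ 7 - 16 * z ^ 6 - 12 * z ^ 5 + 68 * z ^ 4 + 20 * z ^ 3 - 6 * z ^ 2 - 4 * z + 4)
      (-2 * z ^ 7 + 6 * z ^ 6 - 28 * z ^ 3 + 12 * z ^ 2 + 2 * z)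
      (-4 * z ^ 8 - 4 * z ^ 7 + 6 * z ^ 6 + 20 * z ^ 5 - 68 * z ^ 4 - 12 * z ^ 3 + 16 * z ^ 2 -
        2 * z)
      (2 * z ^ 7 - 12 * z ^ 6 - 28 * z ^ 5 - 6 * z ^ 2 - 2 * z) := by
    rw [hAD, hBC]; unfold coords; ring
  have hd : B * D - A * C =
      coords g u
      (6 * z ^ 7 + 9 * z ^ 6 + 6 * z ^ 4 + 9 * z ^ 3 - 6 * z)
      (-18 * z ^ 6 - 12 * z ^ 4)
      (-6 * z ^ 7 + 9 * z ^ 5 - 6 * z ^ 4 - 9 * z ^ 2 + 6 * z)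
      (12 * z ^ 4 + 18 * z ^ 2) := by
    rw [hAC, hBD]; unfold coords; ring
  exact clearedCurve_eq_zero hg hu z hm hS hT hd

/-- For `φ² = 125/4`, the map `z ↦ (σ,τ) = (R(z,φ), 1/R(−ω²z,−φ))` parametrizes the
curve `F₊ = G + φH = 0`. -/
theorem rational_parametrization_conifold (ω φ : ℂ)
    (hω : ω ^ 2 + ω + 1 = 0) (hφ : φ ^ 2 = 125 / 4) :
    ∀ z : ℂ, z ≠ 0 → 5 * z ^ 2 + 2 * φ * z - 5 ≠ 0 →
      5 * (-ω ^ 2 * z) ^ 2 - 2 * φ * (-ω ^ 2 * z) - 5 ≠ 0 →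
      R (-ω ^ 2 * z) (-φ) ≠ 0 →
      G (R z φ) (1 / R (-ω ^ 2 * z) (-φ)) + φ * H (R z φ) (1 / R (-ω ^ 2 * z) (-φ)) = 0 := by
  intro z hz h₁ h₂ h₃
  obtain ⟨g, rfl⟩ : ∃ g : ℂ, φ = 5 * (2 * g - 1) / 2 := ⟨φ / 5 + 1 / 2, by ring⟩
  obtain ⟨u, rfl⟩ : ∃ u : ℂ, ω = u - 1 := ⟨ω + 1, by ring⟩
  have hg : g ^ 2 = g + 1 := by linear_combination hφ / 25
  have hu : u ^ 2 = u - 1 := by linear_combination hω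
  have hy : -(u - 1) ^ 2 * z = u * z := by linear_combination -z * hu
  rw [hy] at h₂ h₃ ⊢
  have hB : 3 * z * (z ^ 2 + (2 * g - 1) * z - 1) ≠ 0 := by
    refine mul_ne_zero (by simpa using hz) fun h ↦ h₁ ?_
    linear_combination 5 * h
  have hσ : R z (5 * (2 * g - 1) / 2) =
      (2 * z ^ 4 + (2 - g) * z ^ 3 + 3 * g * z ^ 2 - (2 - g) * z + 2) /
        (3 * z * (z ^ 2 + (2 * g - 1) * z - 1)) := by
    unfold R
    rw [div_eq_div_iff (mul_ne_zero (by simpa using hz) h₁) hB]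
    ring
  have hτ : 1 / R (u * z) (-(5 * (2 * g - 1) / 2)) =
      3 * (u * z) * ((u * z) ^ 2 - (2 * g - 1) * (u * z) - 1) /
      (2 * (u * z) ^ 4 + (1 + g) * (u * z) ^ 3 + 3 * (1 - g) * (u * z) ^ 2 -
        (1 + g) * (u * z) + 2) := by
    unfold R
    rw [one_div_div]
    refine Eq.trans ?_ (mul_div_mul_left _ _ (by norm_num : (10 : ℂ) ≠ 0))
    congr 1 <;> ring
  have hD : 2 * (u * z) ^ 4 + (1 + g) * (u * z) ^ 3 + 3 * (1 - g) * (u * z) ^ 2 -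
      (1 + g) * (u * z) + 2 ≠ 0 := by
    intro h
    rw [h, div_zero] at hτ
    exact one_div_ne_zero h₃ hτ
  rw [hσ, hτ]
  refine G_add_H_of_clearedCurve hB hD (clearedCurve_parametrization hg hu z ?_ ?_ ?_ ?_)
  · unfold coords; ring
  · unfold coords; ring
  · unfold coords
    linear_combination (3 * z ^ 3 * (u + 1) - 3 * (2 * g - 1) * z ^ 2) * hu
  · unfold coords
    linear_combination (2 * z ^ 4 * (u ^ 2 + u) + (1 + g) * z ^ 3 * (u + 1) +
      3 * (1 - g) * z ^ 2) * hu
end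

section
/- Let δ ∈ ℂ with δ² = 5, and set φ = 5δ/2, σ₀ = (1+δ)/2, τ₀ = (3−δ)/2. Let F₊(σ,τ) = G(σ,τ) + φH(σ,τ). Then at each of the three points (σ₀,σ₀), (σ₀,τ₀), (τ₀,σ₀), the polynomial F₊ and both its partial derivatives ∂F₊/∂σ and ∂F₊/∂τ vanish; i.e., these points are singular points of the curve F₊ = 0. -/
/-- `F₊` is symmetric in its two arguments. -/
theorem Fplus_comm (φ σ τ : ℂ) : Fplus φ σ τ = Fplus φ τ σ := by
  unfold Fplus G H
  ring

/-- The partial derivative of `F₊` with respect to its first argument. -/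
theorem hasDerivAt_Fplus_left (φ σ τ : ℂ) :
    HasDerivAt (fun s : ℂ => Fplus φ s τ)
      (6 * σ * τ ^ 2 -
          (1 / 2) * τ * (1 + τ) * ((1 + 2 * σ) * (1 + σ * τ) + σ * (1 + σ) * τ) +
          (1 - τ + τ ^ 2) * ((2 * σ - 1) * (1 - σ * τ + σ ^ 2 * τ ^ 2) +
            (1 - σ + σ ^ 2) * (2 * σ * τ ^ 2 - τ)) +
        φ * (τ * (1 - τ) * ((1 - 2 * σ) * (1 - σ * τ) - σ * (1 - σ) * τ))) σ := by
  have h := hasDerivAt_id' σ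
  have hτ := h.mul_const τ
  have hG₁ := ((h.pow 2).const_mul 3).mul_const (τ ^ 2)
  have hG₂ := (((((h.const_mul (1 / 2)).mul_const τ).mul (h.const_add 1)).mul_const
    (1 + τ)).mul (hτ.const_add 1))
  have hG₃ := (((h.const_sub 1).add (h.pow 2)).mul_const (1 - τ + τ ^ 2)).mul
    ((hτ.const_sub 1).add ((h.pow 2).mul_const (τ ^ 2)))
  have hH := ((hτ.mul (h.const_sub 1)).mul_const (1 - τ)).mul (hτ.const_sub 1)
  refine (((hG₁.sub hG₂).add hG₃).add (hH.const_mul φ)).congr_deriv ?_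
  simp only [Pi.pow_apply, Pi.mul_apply, Pi.add_apply]
  push_cast
  ring

/-- At the conifold value `φ = 5√5/2`, the curve `F₊ = 0` has singular points at
`((1+√5)/2, (1+√5)/2)`, `((1+√5)/2, (3−√5)/2)` and `((3−√5)/2, (1+√5)/2)`:
`F₊` and both of its partial derivatives vanish at each of these points. -/
theorem conifold_extra_nodes (δ φ σ₀ τ₀ : ℂ)
    (hδ : δ ^ 2 = 5) (hφ : φ = 5 * δ / 2)
    (hσ₀ : σ₀ = (1 + δ) / 2) (hτ₀ : τ₀ = (3 - δ) / 2) :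
    (Fplus φ σ₀ σ₀ = 0 ∧
      deriv (fun σ : ℂ => Fplus φ σ σ₀) σ₀ = 0 ∧
      deriv (fun τ : ℂ => Fplus φ σ₀ τ) σ₀ = 0) ∧
    (Fplus φ σ₀ τ₀ = 0 ∧
      deriv (fun σ : ℂ => Fplus φ σ τ₀) σ₀ = 0 ∧
      deriv (fun τ : ℂ => Fplus φ σ₀ τ) τ₀ = 0) ∧
    (Fplus φ τ₀ σ₀ = 0 ∧
      deriv (fun σ : ℂ => Fplus φ σ σ₀) τ₀ = 0 ∧
      deriv (fun τ : ℂ => Fplus φ τ₀ τ) σ₀ = 0) := by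
  have deriv_right (σ τ : ℂ) :
      deriv (fun t : ℂ => Fplus φ σ t) τ = deriv (fun t : ℂ => Fplus φ t σ) τ := by
    simp only [Fplus_comm φ σ]
  simp only [deriv_right, (hasDerivAt_Fplus_left _ _ _).deriv]
  subst hφ hσ₀ hτ₀
  unfold Fplus G H
  refine ⟨⟨?_, ?_, ?_⟩, ⟨?_, ?_, ?_⟩, ⟨?_, ?_, ?_⟩⟩ <;> grind
end
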